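/- arXiv:2209.05338 — 2 statements merged into one kernel-verified Lean document; each statement's English description precedes it below -/
import Mathlib

section
/- Fix θ ∈ (0, π/2] and set a = (cos(θ/2), sin(θ/2), 0), b = (cos(θ/2), -sin(θ/2), 0) in ℝ³; X = {+a,−a,+b,−b}; ε(±a) = (1/8)(I ± a·σ), ε(±b) = (1/8)(I ± b·σ); M^st(±a) = (1/4)(I ± a·σ), M^st(±b) = (1/4)(I ± b·σ). Define priority lists: outcome +a ↦ (+a,+b,−b,−a); −a ↦ (−a,−b,+b,+a); +b ↦ (+b,+a,−a,−b); −b ↦ (−b,−a,+a,+b), and for an excluded set S ⊂ X let g(z,S) be the first element of the priority list of outcome z not belonging to S. Then the success probability with two excluded wrong answers, E₂ = Σ_{x∈X} (1/3) Σ_{S ⊆ X∖{x}, |S|=2} Σ_{z∈X} tr(ε(x) M^st(z)) · [g(z,S) = x], equals (4 + cos²(θ/2))/6. -/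
open Matrix

/-- For `v = (v₁, v₂, v₃) ∈ ℝ³`, the matrix `v·σ = v₁σ₁ + v₂σ₂ + v₃σ₃` where
`σ₁, σ₂, σ₃` are the Pauli matrices. -/
noncomputable def pauli (v : Fin 3 → ℝ) : Matrix (Fin 2) (Fin 2) ℂ :=
  (v 0 : ℂ) • !![0, 1; 1, 0] + (v 1 : ℂ) • !![0, -Complex.I; Complex.I, 0] +
    (v 2 : ℂ) • !![1, 0; 0, -1]

/-- The Bloch vector `a = (cos(θ/2), sin(θ/2), 0)`. -/
noncomputable def aVec (θ : ℝ) : Fin 3 → ℝ := ![Real.cos (θ/2), Real.sin (θ/2), 0]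

/-- The Bloch vector `b = (cos(θ/2), -sin(θ/2), 0)`. -/
noncomputable def bVec (θ : ℝ) : Fin 3 → ℝ := ![Real.cos (θ/2), -Real.sin (θ/2), 0]

/-- The four inputs `X = {+a, -a, +b, -b}`, indexed as `0 ↦ +a`, `1 ↦ -a`, `2 ↦ +b`,
`3 ↦ -b`. -/
noncomputable def vecX (θ : ℝ) : Fin 4 → Fin 3 → ℝ := ![aVec θ, -aVec θ, bVec θ, -bVec θ]

/-- The state ensemble `ε(±a) = (1/8)(I ± a·σ)`, `ε(±b) = (1/8)(I ± b·σ)`. -/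
noncomputable def eps (θ : ℝ) (x : Fin 4) : Matrix (Fin 2) (Fin 2) ℂ :=
  (1/8 : ℂ) • (1 + pauli (vecX θ x))

/-- The standard measurement `M^st(±a) = (1/4)(I ± a·σ)`, `M^st(±b) = (1/4)(I ± b·σ)`. -/
noncomputable def Mst (θ : ℝ) (z : Fin 4) : Matrix (Fin 2) (Fin 2) ℂ :=
  (1/4 : ℂ) • (1 + pauli (vecX θ z))

/-- The relabeling priority lists (in the indexing `0 ↦ +a`, `1 ↦ -a`, `2 ↦ +b`, `3 ↦ -b`):
outcome `+a ↦ (+a, +b, -b, -a)`, `-a ↦ (-a, -b, +b, +a)`, `+b ↦ (+b, +a, -a, -b)`,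
`-b ↦ (-b, -a, +a, +b)`. -/
def prio : Fin 4 → List (Fin 4) := ![[0, 2, 3, 1], [1, 3, 2, 0], [2, 0, 1, 3], [3, 1, 0, 2]]

/-- `guess z S` is the first element of the priority list of outcome `z` not belonging to
the excluded set `S`. -/
def guess (z : Fin 4) (S : Finset (Fin 4)) : Fin 4 :=
  ((prio z).filter (fun y => decide (y ∉ S))).headI
/-- The number of two-element sets `S ∌ x` of excluded answers for which outcome `z` is
relabeled to `x`: it is `3 - k` when `x` is preceded by `k` entries in the list of `z`. -/
theorem card_exclusions_guess_eq (x z : Fin 4) :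
    (Finset.univ.filter (fun S : Finset (Fin 4) =>
      (x ∉ S ∧ S.card = 2) ∧ guess z S = x)).card = 3 - (prio z).idxOf x := by
  revert x z
  decide

theorem trace_one_add_pauli_mul (v w : Fin 3 → ℝ) :
    ((1 + pauli v) * (1 + pauli w)).trace = 2 * (1 + ((v ⬝ᵥ w : ℝ) : ℂ)) := by
  simp only [pauli, Matrix.trace_fin_two, Matrix.mul_apply, Fin.sum_univ_two, dotProduct,
    Fin.sum_univ_three, Matrix.add_apply, Matrix.smul_apply, Matrix.one_apply]
  simp
  linear_combination (-2 * (v 1 : ℂ) * w 1) * Complex.I_sq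

theorem trace_eps_mul_Mst (θ : ℝ) (x z : Fin 4) :
    (eps θ x * Mst θ z).trace = (1 + ((vecX θ x ⬝ᵥ vecX θ z : ℝ) : ℂ)) / 16 := by
  rw [eps, Mst, smul_mul_smul_comm, Matrix.trace_smul, trace_one_add_pauli_mul, smul_eq_mul]
  ring

theorem standard_measurement_two_exclusions (θ : ℝ) (hθ : θ ∈ Set.Ioc 0 (Real.pi / 2)) :
    (∑ x : Fin 4, (1/3 : ℂ) *
        ∑ S ∈ Finset.univ.filter (fun S : Finset (Fin 4) => x ∉ S ∧ S.card = 2),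
          ∑ z : Fin 4,
            (eps θ x * Mst θ z).trace * (if guess z S = x then 1 else 0)) =
      (((4 + Real.cos (θ/2) ^ 2) / 6 : ℝ) : ℂ) := by
  have count (x : Fin 4) :
      ∑ S ∈ Finset.univ.filter (fun S : Finset (Fin 4) => x ∉ S ∧ S.card = 2),
        ∑ z : Fin 4, (eps θ x * Mst θ z).trace * (if guess z S = x then 1 else 0) =
      ∑ z : Fin 4, (eps θ x * Mst θ z).trace * ((3 - (prio z).idxOf x : ℕ) : ℂ) := by
    rw [Finset.sum_comm]
    refine Finset.sum_congr rfl fun z _ => ?_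
    rw [← Finset.mul_sum, Finset.sum_boole, Finset.filter_filter, card_exclusions_guess_eq]
  have trig : Complex.sin (θ / 2) ^ 2 + Complex.cos (θ / 2) ^ 2 = 1 :=
    Complex.sin_sq_add_cos_sq _
  simp_rw [count]
  simp only [trace_eps_mul_Mst, Fin.sum_univ_four]
  simp [prio, vecX, aVec, bVec, dotProduct, Fin.sum_univ_three]
  linear_combination (1 / 6 : ℂ) * trig
end

section
/- Fix θ ∈ (0, π/2] and set a = (cos(θ/2), sin(θ/2), 0), b = (cos(θ/2), -sin(θ/2), 0) in ℝ³; ε(±a) = (1/8)(I ± a·σ), ε(±b) = (1/8)(I ± b·σ). Let m = (a+3b)/√(10+6cos θ), n = (3a+b)/√(10+6cos θ) and M^an(±m) = (1/4)(I ± m·σ), M^an(±n) = (1/4)(I ± n·σ). Under the assignment ±n ↦ ±a and ±m ↦ ±b (no posterior information), the success probability equals tr(ε(+a)M^an(+n)) + tr(ε(−a)M^an(−n)) + tr(ε(+b)M^an(+m)) + tr(ε(−b)M^an(−m)) = (1/4)(1 + (3+cos θ)/√(10+6cos θ)). -/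
open Matrix

/-- The Bloch vector `m = (a + 3b)/√(10 + 6 cos θ)`. -/
noncomputable def mVec (θ : ℝ) : Fin 3 → ℝ :=
  (Real.sqrt (10 + 6 * Real.cos θ))⁻¹ • (aVec θ + (3 : ℝ) • bVec θ)

/-- The Bloch vector `n = (3a + b)/√(10 + 6 cos θ)`. -/
noncomputable def nVec (θ : ℝ) : Fin 3 → ℝ :=
  (Real.sqrt (10 + 6 * Real.cos θ))⁻¹ • ((3 : ℝ) • aVec θ + bVec θ)

/-- The outcome set `Z = {+n, -n, +m, -m}` of the anticipative measurement, indexed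
consistently with the priority lists: `0 ↦ +n`, `1 ↦ -n`, `2 ↦ +m`, `3 ↦ -m`. -/
noncomputable def vecZ (θ : ℝ) : Fin 4 → Fin 3 → ℝ := ![nVec θ, -nVec θ, mVec θ, -mVec θ]

/-- The anticipative measurement `M^an(±m) = (1/4)(I ± m·σ)`, `M^an(±n) = (1/4)(I ± n·σ)`. -/
noncomputable def Man (θ : ℝ) (z : Fin 4) : Matrix (Fin 2) (Fin 2) ℂ :=
  (1/4 : ℂ) • (1 + pauli (vecZ θ z))

theorem trace_one_add_pauli_mul_one_add_pauli (v w : Fin 3 → ℝ) :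
    ((1 + pauli v) * (1 + pauli w)).trace = ((2 * (1 + v ⬝ᵥ w) : ℝ) : ℂ) := by
  simp [pauli, Matrix.trace_fin_two, Matrix.mul_apply, Fin.sum_univ_two, dotProduct,
    Fin.sum_univ_three]
  linear_combination (-2 * (v 1 : ℂ) * w 1) * Complex.I_sq

theorem trace_eps_mul_Man (θ : ℝ) (x z : Fin 4) :
    (eps θ x * Man θ z).trace = ((1 / 16 * (1 + vecX θ x ⬝ᵥ vecZ θ z) : ℝ) : ℂ) := by
  rw [eps, Man, smul_mul_smul_comm, Matrix.trace_smul,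
    trace_one_add_pauli_mul_one_add_pauli, smul_eq_mul]
  push_cast
  ring

theorem aVec_dotProduct_nVec (θ : ℝ) :
    aVec θ ⬝ᵥ nVec θ = (3 + Real.cos θ) / Real.sqrt (10 + 6 * Real.cos θ) := by
  have hc : Real.cos θ = 2 * Real.cos (θ / 2) ^ 2 - 1 := by
    rw [← Real.cos_two_mul, mul_div_cancel₀ θ two_ne_zero]
  have hs := Real.sin_sq_add_cos_sq (θ / 2)
  simp only [aVec, nVec, bVec, dotProduct, Fin.sum_univ_three, Pi.smul_apply, Pi.add_apply,
    smul_eq_mul, cons_val]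
  linear_combination (Real.sqrt (10 + 6 * Real.cos θ))⁻¹ * (2 * hs - hc)

theorem bVec_dotProduct_mVec (θ : ℝ) :
    bVec θ ⬝ᵥ mVec θ = (3 + Real.cos θ) / Real.sqrt (10 + 6 * Real.cos θ) := by
  rw [← aVec_dotProduct_nVec]
  simp only [aVec, nVec, bVec, mVec, dotProduct, Fin.sum_univ_three, Pi.smul_apply,
    Pi.add_apply, smul_eq_mul, cons_val]
  ring

theorem anticipative_measurement_no_cpost (θ : ℝ) (hθ : θ ∈ Set.Ioc 0 (Real.pi / 2)) :
    (eps θ 0 * Man θ 0).trace + (eps θ 1 * Man θ 1).trace +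
      (eps θ 2 * Man θ 2).trace + (eps θ 3 * Man θ 3).trace =
      (((1/4) * (1 + (3 + Real.cos θ) / Real.sqrt (10 + 6 * Real.cos θ)) : ℝ) : ℂ) := by
  simp only [trace_eps_mul_Man, ← Complex.ofReal_add]
  congr 1
  simp only [vecX, vecZ, cons_val, neg_dotProduct_neg, aVec_dotProduct_nVec,
    bVec_dotProduct_mVec]
  ring
end
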